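/- Let G = (V, E) be a digraph rooted at v. Then κ(G) = Π_{u ∈ V} κ_u(H_u[{u, u₁, …, u_i}]), where for each vertex u, {u₁, …, u_i} = imm_G(u) is the set of vertices immediately dominated by u, and H_u = G(dom_G(u₁) → u₁; …; dom_G(u_i) → u_i) is obtained from G by contracting, for each j, the set of vertices dominated by u_j into u_j. -/

import Mathlib

open MvPolynomial

/-- A finite directed (multi)graph with abstractly named edges: a finite set of
vertices, a finite set of edge names, and source/target maps.  Edge names double
as the labels/variables of the Kirchhoff polynomial. -/
structure MultiDigraph (V : Type*) (ε : Type*) where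
  verts : Finset V
  edges : Finset ε
  src : ε → V
  tgt : ε → V

namespace MultiDigraph

variable {V : Type*} {ε : Type*} [DecidableEq V] [DecidableEq ε]

/-- One step along an edge of `A`. -/
def Step (G : MultiDigraph V ε) (A : Finset ε) (x y : V) : Prop :=
  ∃ e ∈ A, G.src e = x ∧ G.tgt e = y

/-- Directed reachability using only edges of `A`. -/
def Reaches (G : MultiDigraph V ε) (A : Finset ε) (x y : V) : Prop :=
  Relation.ReflTransGen (G.Step A) x y

/-- Every edge has both of its endpoints among the vertices. -/
def WellFormed (G : MultiDigraph V ε) : Prop :=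
  ∀ e ∈ G.edges, G.src e ∈ G.verts ∧ G.tgt e ∈ G.verts

/-- `G` is a simple digraph: it has no loops and no parallel edges. -/
def Simple (G : MultiDigraph V ε) : Prop :=
  (∀ e ∈ G.edges, G.src e ≠ G.tgt e) ∧
    ∀ e ∈ G.edges, ∀ e' ∈ G.edges, G.src e = G.src e' → G.tgt e = G.tgt e' → e = e'

/-- `A` is (the edge set of) an arborescence of `G` rooted at `r`: a spanning
subdigraph in which every vertex other than the root has exactly one incoming
edge, the root has none, and every vertex is reachable from the root (hence
along a unique directed path). -/
def IsArbAt (G : MultiDigraph V ε) (A : Finset ε) (r : V) : Prop :=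
  A ⊆ G.edges ∧ r ∈ G.verts ∧
  (∀ e ∈ A, G.src e ∈ G.verts ∧ G.tgt e ∈ G.verts) ∧
  (∀ e ∈ A, G.tgt e ≠ r) ∧
  (∀ w ∈ G.verts, w ≠ r → ∃! e, e ∈ A ∧ G.tgt e = w) ∧
  (∀ w ∈ G.verts, G.Reaches A r w)

/-- `A` is an arborescence of `G` (rooted at some vertex). -/
def IsArb (G : MultiDigraph V ε) (A : Finset ε) : Prop :=
  ∃ r, G.IsArbAt A r

open Classical in
/-- The Kirchhoff polynomial of `G`: the sum, over all arborescences, of the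
products of the variables of their edges. -/
noncomputable def kirchhoff (G : MultiDigraph V ε) : MvPolynomial ε ℚ :=
  ∑ A ∈ G.edges.powerset.filter (fun A => G.IsArb A), ∏ e ∈ A, X e

open Classical in
/-- The Kirchhoff polynomial of arborescences of `G` rooted at `r`. -/
noncomputable def kirchhoffAt (G : MultiDigraph V ε) (r : V) : MvPolynomial ε ℚ :=
  ∑ A ∈ G.edges.powerset.filter (fun A => G.IsArbAt A r), ∏ e ∈ A, X e

/-- The incoming edges of vertex `v`. -/
def inEdges (G : MultiDigraph V ε) (v : V) : Finset ε :=
  G.edges.filter (fun e => G.tgt e = v)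

/-- `G` is rooted at `v`: `v` has no incoming edges and every vertex is
reachable from `v`. -/
def RootedAt (G : MultiDigraph V ε) (v : V) : Prop :=
  v ∈ G.verts ∧ (∀ e ∈ G.edges, G.tgt e ≠ v) ∧ ∀ w ∈ G.verts, G.Reaches G.edges v w

/-- `G` is strongly connected. -/
def StronglyConnected (G : MultiDigraph V ε) : Prop :=
  ∀ x ∈ G.verts, ∀ y ∈ G.verts, G.Reaches G.edges x y

/-- `G` is (weakly) connected. -/
def WeaklyConnected (G : MultiDigraph V ε) : Prop :=
  ∀ x ∈ G.verts, ∀ y ∈ G.verts,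
    Relation.ReflTransGen (fun a b => G.Step G.edges a b ∨ G.Step G.edges b a) x y

/-- The induced subdigraph `G[D]`. -/
def induce (G : MultiDigraph V ε) (D : Finset V) : MultiDigraph V ε where
  verts := D
  edges := G.edges.filter (fun e => G.src e ∈ D ∧ G.tgt e ∈ D)
  src := G.src
  tgt := G.tgt

/-- `root_u(G)`: remove all edges incoming to `u`. -/
def rootAt (G : MultiDigraph V ε) (u : V) : MultiDigraph V ε where
  verts := G.verts
  edges := G.edges.filter (fun e => G.tgt e ≠ u)
  src := G.src
  tgt := G.tgt

/-- Delete a single edge. -/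
def deleteEdge (G : MultiDigraph V ε) (e₀ : ε) : MultiDigraph V ε where
  verts := G.verts
  edges := G.edges.erase e₀
  src := G.src
  tgt := G.tgt

/-- The contraction `G(S → u)`: all edges from `Vᶜ∖S` into `S∖{u}` and all edges
inside `S` are removed, and `S` is contracted into the single vertex `u`;
edges retain their names (labels). -/
def contract (G : MultiDigraph V ε) (S : Finset V) (u : V) : MultiDigraph V ε where
  verts := insert u (G.verts \ S)
  edges := G.edges.filter (fun e => G.tgt e ∉ S ∨ (G.src e ∉ S ∧ G.tgt e = u))
  src := fun e => if G.src e ∈ S then u else G.src e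
  tgt := fun e => if G.tgt e ∈ S then u else G.tgt e

/-- Directed walks from `x` to `y`, given as lists of edges taken from `A`. -/
def IsWalk (G : MultiDigraph V ε) (A : Finset ε) : List ε → V → V → Prop
  | [], x, y => x = y
  | e :: p, x, y => e ∈ A ∧ G.src e = x ∧ IsWalk G A p (G.tgt e) y

/-- A simple directed path from `x` to `y` (no repeated vertices). -/
def IsPath (G : MultiDigraph V ε) (A : Finset ε) (p : List ε) (x y : V) : Prop :=
  G.IsWalk A p x y ∧ (x :: p.map G.tgt).Nodup

/-- A simple directed cycle through `x` (no repeated vertices). -/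
def IsCycle (G : MultiDigraph V ε) (A : Finset ε) (p : List ε) (x : V) : Prop :=
  p ≠ [] ∧ G.IsWalk A p x x ∧ (p.map G.tgt).Nodup

/-- The edge set `A` contains no directed cycle. -/
def Acyclic (G : MultiDigraph V ε) (A : Finset ε) : Prop :=
  ¬ ∃ p x, G.IsCycle A p x

/-- In `G` rooted at `v`, vertex `u` dominates vertex `w`: every directed path
from `v` to `w` passes through `u`. -/
def Dominates (G : MultiDigraph V ε) (v u w : V) : Prop :=
  ∀ p : List ε, G.IsPath G.edges p v w → u ∈ v :: p.map G.tgt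

open Classical in
/-- `dom_G(u)` (w.r.t. the root `v`): the set of all vertices dominated by `u`. -/
noncomputable def domSet (G : MultiDigraph V ε) (v u : V) : Finset V :=
  G.verts.filter (fun w => G.Dominates v u w)

/-- In `G` rooted at `v`, `y` is an immediate dominator of `z`. -/
def ImmDominates (G : MultiDigraph V ε) (v y z : V) : Prop :=
  y ≠ z ∧ G.Dominates v y z ∧
    ∀ x ∈ G.verts, x ≠ y → x ≠ z → G.Dominates v x z → G.Dominates v x y

open Classical in
/-- `imm_G(y)` (w.r.t. the root `v`): the set of vertices immediately dominated by `y`. -/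
noncomputable def immSet (G : MultiDigraph V ε) (v y : V) : Finset V :=
  G.verts.filter (fun z => G.ImmDominates v y z)

open Classical in
/-- The simultaneous contraction `G(dom(z₁) → z₁; …; dom(z_i) → z_i)` for
`Z = {z₁, …, z_i}` (domination w.r.t. the root `v`). -/
noncomputable def domContract (G : MultiDigraph V ε) (v : V) (Z : Finset V) :
    MultiDigraph V ε where
  verts := G.verts.filter (fun x => ∀ z ∈ Z, G.Dominates v z x → x = z)
  edges := G.edges.filter (fun e =>
    (∀ z ∈ Z, ¬(G.Dominates v z (G.src e) ∧ G.Dominates v z (G.tgt e))) ∧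
    (∀ z ∈ Z, ¬(¬ G.Dominates v z (G.src e) ∧ G.Dominates v z (G.tgt e) ∧ G.tgt e ≠ z)))
  src := fun e =>
    if h : ∃ z ∈ Z, G.Dominates v z (G.src e) ∧ G.src e ≠ z then h.choose else G.src e
  tgt := fun e =>
    if h : ∃ z ∈ Z, G.Dominates v z (G.tgt e) ∧ G.tgt e ≠ z then h.choose else G.tgt e

/-- Mutual directed reachability in `G`. -/
def MutuallyReachable (G : MultiDigraph V ε) (x y : V) : Prop :=
  G.Reaches G.edges x y ∧ G.Reaches G.edges y x

open Classical in
/-- `W` is (the vertex set of) a strongly connected component of `G`, i.e. an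
equivalence class of mutual reachability. -/
def IsSCC (G : MultiDigraph V ε) (W : Finset V) : Prop :=
  ∃ x ∈ G.verts, W = G.verts.filter (fun y => G.MutuallyReachable x y)

/-- `W` is a minimal element in the partial order that reachability induces on
the strongly connected components of `G` (an initial SCC). -/
def IsMinimalSCC (G : MultiDigraph V ε) (W : Finset V) : Prop :=
  G.IsSCC W ∧ ∀ W', G.IsSCC W' → (∃ x ∈ W', ∃ y ∈ W, G.Reaches G.edges x y) → W' = W

open Classical in
/-- The digraph `Ĝ(W)` associated with a strongly connected component `G[W]`:
if `G[W]` has no incoming edges (it is the initial SCC) it is `G[W]` itself;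
otherwise a new auxiliary vertex (here `none`) is added and every edge of `G`
entering `W` from outside is redirected to start at the auxiliary vertex,
keeping its label. -/
noncomputable def hatSCC (G : MultiDigraph V ε) (W : Finset V) :
    MultiDigraph (Option V) ε where
  verts :=
    if ∃ e ∈ G.edges, G.tgt e ∈ W ∧ G.src e ∉ W then insert none (W.image some)
    else W.image some
  edges := G.edges.filter (fun e => G.tgt e ∈ W)
  src := fun e => if G.src e ∈ W then some (G.src e) else none
  tgt := fun e => some (G.tgt e)

/-- `u` is an independent vertex of the simple directed cycle `C` (w.r.t. the
root `v`): `u` lies on `C` and there is a simple directed path from `v` to `u`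
which is vertex-disjoint from `C` except at `u`. -/
def IsIndependentVertex (G : MultiDigraph V ε) (v : V) (C : List ε) (u : V) : Prop :=
  u ∈ C.map G.tgt ∧ ∃ p, G.IsPath G.edges p v u ∧
    ∀ z ∈ v :: p.map G.tgt, z ∈ C.map G.tgt → z = u

end MultiDigraph

namespace MultiDigraph

variable {V : Type*} {ε : Type*}

/-! ### Walks and domination -/

/-- There is a walk from `v` to `w` that never visits `u`. -/
def AvoidsTo (G : MultiDigraph V ε) (v u w : V) : Prop :=
  v ≠ u ∧ Relation.ReflTransGen (fun a b => G.Step G.edges a b ∧ b ≠ u) v w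

theorem IsWalk.append {G : MultiDigraph V ε} {A : Finset ε} {e : ε} (he : e ∈ A) :
    ∀ {p : List ε} {x : V}, G.IsWalk A p x (G.src e) → G.IsWalk A (p ++ [e]) x (G.tgt e)
  | [], _, h => ⟨he, h.symm, rfl⟩
  | _ :: _, _, h => ⟨h.1, h.2.1, IsWalk.append he h.2.2⟩

theorem IsWalk.exists_prefix {G : MultiDigraph V ε} {A : Finset ε} {b y : V} :
    ∀ {p : List ε} {x : V}, G.IsWalk A p x y → b ∈ x :: p.map G.tgt →
      ∃ q, q <+: p ∧ G.IsWalk A q x b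
  | p, x, h, hb => by
    by_cases hbx : b = x
    · exact ⟨[], List.nil_prefix, hbx.symm⟩
    · match p, h with
      | [], _ => simp [hbx] at hb
      | e :: p, h =>
        have hb' : b ∈ G.tgt e :: p.map G.tgt := by simpa [hbx] using hb
        obtain ⟨q, hq, hw⟩ := IsWalk.exists_prefix h.2.2 hb'
        exact ⟨e :: q, (List.prefix_cons_inj e).2 hq, h.1, h.2.1, hw⟩

theorem IsWalk.reflTransGen_avoiding {G : MultiDigraph V ε} {A : Finset ε} {u y : V} :
    ∀ {p : List ε} {x : V}, G.IsWalk A p x y → u ∉ p.map G.tgt →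
      Relation.ReflTransGen (fun a b => G.Step A a b ∧ b ≠ u) x y
  | [], _, h, _ => by
    cases h
    exact .refl
  | e :: p, x, h, hu => by
    simp only [List.map_cons, List.mem_cons, not_or] at hu
    exact .head ⟨⟨e, h.1, h.2.1, rfl⟩, Ne.symm hu.1⟩ (IsWalk.reflTransGen_avoiding h.2.2 hu.2)

theorem AvoidsTo.exists_isPath {G : MultiDigraph V ε} {v u w : V} (h : G.AvoidsTo v u w) :
    ∃ p, G.IsPath G.edges p v w ∧ u ∉ v :: p.map G.tgt := by
  obtain ⟨hvu, h⟩ := h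
  induction h with
  | refl => exact ⟨[], ⟨rfl, by simp⟩, by simpa using hvu.symm⟩
  | @tail a b _ hab ih =>
    obtain ⟨p, ⟨hw, hnd⟩, hu⟩ := ih
    obtain ⟨⟨e, he, rfl, rfl⟩, hbu⟩ := hab
    by_cases hb : G.tgt e ∈ v :: p.map G.tgt
    · obtain ⟨q, hq, hqw⟩ := hw.exists_prefix hb
      have hsub : (v :: q.map G.tgt).Sublist (v :: p.map G.tgt) :=
        (hq.sublist.map G.tgt).cons_cons v
      exact ⟨q, ⟨hqw, hnd.sublist hsub⟩, fun h => hu (hsub.subset h)⟩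
    · refine ⟨p ++ [e], ⟨hw.append he, ?_⟩, ?_⟩
      · rw [List.map_append, ← List.cons_append]
        exact List.Nodup.append hnd (by simp) (by simpa using hb)
      · rw [List.map_append, ← List.cons_append]
        simp only [List.mem_append, not_or]
        exact ⟨hu, by simpa using Ne.symm hbu⟩

theorem not_dominates_iff {G : MultiDigraph V ε} {v u w : V} :
    ¬ G.Dominates v u w ↔ G.AvoidsTo v u w := by
  constructor
  · intro h
    simp only [Dominates, not_forall] at h
    obtain ⟨p, hp, hu⟩ := h
    simp only [List.mem_cons, not_or] at hu
    exact ⟨Ne.symm hu.1, hp.1.reflTransGen_avoiding hu.2⟩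
  · rintro h hd
    obtain ⟨p, hp, hu⟩ := h.exists_isPath
    exact hu (hd p hp)

theorem dominates_iff {G : MultiDigraph V ε} {v u w : V} :
    G.Dominates v u w ↔ ¬ G.AvoidsTo v u w := by
  rw [← not_dominates_iff, not_not]

theorem AvoidsTo.step {G : MultiDigraph V ε} {v u w : V} {e : ε} (h : G.AvoidsTo v u (G.src e))
    (he : e ∈ G.edges) (hw : G.tgt e = w) (hu : w ≠ u) : G.AvoidsTo v u w :=
  ⟨h.1, h.2.tail ⟨⟨e, he, rfl, hw⟩, hu⟩⟩

theorem AvoidsTo.refl {G : MultiDigraph V ε} {v u : V} (h : v ≠ u) : G.AvoidsTo v u v :=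
  ⟨h, .refl⟩

theorem Dominates.refl (G : MultiDigraph V ε) (v w : V) : G.Dominates v w w := by
  rw [dominates_iff]
  rintro ⟨hne, h⟩
  rcases Relation.ReflTransGen.cases_tail h with h | ⟨_, _, h⟩
  · exact hne h.symm
  · exact h.2 rfl

theorem Dominates.root (G : MultiDigraph V ε) (v w : V) : G.Dominates v v w :=
  fun _ _ => List.mem_cons_self

theorem Dominates.trans {G : MultiDigraph V ε} {v a b c : V} (hab : G.Dominates v a b)
    (hbc : G.Dominates v b c) : G.Dominates v a c := by
  rw [dominates_iff] at *
  rintro ⟨hva, h⟩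
  refine hbc ?_
  clear hbc
  induction h with
  | refl => exact .refl fun h => hab (h ▸ .refl hva)
  | @tail x y hx hxy ih =>
    obtain ⟨⟨e, he, rfl, rfl⟩, hya⟩ := hxy
    refine ih.step he rfl fun h => hab ?_
    exact AvoidsTo.step ⟨hva, hx⟩ he h (h ▸ hya)

theorem Dominates.antisymm {G : MultiDigraph V ε} {v a b : V} (hab : G.Dominates v a b)
    (hba : G.Dominates v b a) (hb : G.Reaches G.edges v b) : a = b := by
  by_contra hne
  rw [dominates_iff] at hab hba
  have key : ∀ w, G.Reaches G.edges v w → G.AvoidsTo v a w ∧ G.AvoidsTo v b w := by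
    intro w hw
    induction hw with
    | refl =>
      refine ⟨.refl ?_, .refl ?_⟩
      · rintro rfl
        exact hba (.refl hne)
      · rintro rfl
        exact hab (.refl (Ne.symm hne))
    | tail _ hxy ih =>
      obtain ⟨e, he, rfl, rfl⟩ := hxy
      refine ⟨ih.1.step he rfl fun h => ?_, ih.2.step he rfl fun h => ?_⟩
      · exact hba (ih.2.step he h hne)
      · exact hab (ih.1.step he h (Ne.symm hne))
  exact hab (key b hb).1

theorem Dominates.total {G : MultiDigraph V ε} {v a b c : V} (hac : G.Dominates v a c)
    (hbc : G.Dominates v b c) (hc : G.Reaches G.edges v c) :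
    G.Dominates v a b ∨ G.Dominates v b a := by
  by_contra! h
  obtain ⟨hab, hba⟩ := h
  rw [not_dominates_iff] at hab hba
  have key : ∀ w, G.Reaches G.edges v w → G.AvoidsTo v a w ∨ G.AvoidsTo v b w := by
    intro w hw
    induction hw with
    | refl => exact .inl (.refl hab.1)
    | @tail x y _ hxy ih =>
      obtain ⟨e, he, rfl, rfl⟩ := hxy
      by_cases hya : G.tgt e = a
      · exact .inr (hya ▸ hba)
      by_cases hyb : G.tgt e = b
      · exact .inl (hyb ▸ hab)
      exact ih.imp (·.step he rfl hya) (·.step he rfl hyb)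
  exact (key c hc).elim (dominates_iff.1 hac) (dominates_iff.1 hbc)

theorem Dominates.src_of_tgt {G : MultiDigraph V ε} {v u : V} {e : ε}
    (h : G.Dominates v u (G.tgt e)) (he : e ∈ G.edges) (hne : u ≠ G.tgt e) :
    G.Dominates v u (G.src e) := by
  rw [dominates_iff] at *
  exact fun h' => h (h'.step he rfl (Ne.symm hne))

theorem mem_domSet {G : MultiDigraph V ε} {v u w : V} :
    w ∈ G.domSet v u ↔ w ∈ G.verts ∧ G.Dominates v u w := by
  simp [domSet]

theorem mem_immSet {G : MultiDigraph V ε} {v u w : V} :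
    w ∈ G.immSet v u ↔ w ∈ G.verts ∧ G.ImmDominates v u w := by
  simp [immSet]

theorem Dominates.domSet_subset {G : MultiDigraph V ε} {v a b : V} (h : G.Dominates v a b) :
    G.domSet v b ⊆ G.domSet v a := by
  intro w hw
  rw [mem_domSet] at *
  exact ⟨hw.1, h.trans hw.2⟩

/-- Among nested dominator sets, cardinality detects domination. -/
theorem dominates_of_card_le {G : MultiDigraph V ε} {v a b : V} (h : G.Dominates v a b)
    (ha : a ∈ G.verts) (hc : (G.domSet v a).card ≤ (G.domSet v b).card) : G.Dominates v b a := by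
  have := Finset.eq_of_subset_of_card_le h.domSet_subset hc
  exact (mem_domSet.1 (this ▸ mem_domSet.2 ⟨ha, .refl G v a⟩)).2

/-! ### Immediate dominators -/

theorem exists_immSet {G : MultiDigraph V ε} {v y : V} (hroot : G.RootedAt v)
    (hy : y ∈ G.verts) (hyv : y ≠ v) :
    ∃ u ∈ G.verts, y ∈ G.immSet v u := by
  classical
  obtain ⟨u, hu, hmin⟩ := Finset.exists_min_image
    (G.verts.filter fun u => u ≠ y ∧ G.Dominates v u y) (fun u => (G.domSet v u).card)
    ⟨v, by simp [hroot.1, Ne.symm hyv, Dominates.root]⟩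
  simp only [Finset.mem_filter] at hu hmin
  refine ⟨u, hu.1, mem_immSet.2 ⟨hy, hu.2.1, hu.2.2, fun x hx _ hxy hxd => ?_⟩⟩
  rcases hxd.total hu.2.2 (hroot.2.2 y hy) with h | h
  · exact h
  · exact dominates_of_card_le h hu.1 (hmin x ⟨hx, hxy, hxd⟩)

theorem immSet_unique {G : MultiDigraph V ε} {v u u' y : V} (hroot : G.RootedAt v)
    (hu : u ∈ G.verts) (hu' : u' ∈ G.verts) (h : y ∈ G.immSet v u) (h' : y ∈ G.immSet v u') :
    u = u' := by
  rw [mem_immSet] at h h'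
  by_contra hne
  exact hne ((h'.2.2.2 u hu hne h.2.1 h.2.2.1).antisymm
    (h.2.2.2 u' hu' (Ne.symm hne) h'.2.1 h'.2.2.1) (hroot.2.2 u' hu'))

theorem exists_immSet_dominates {G : MultiDigraph V ε} {v u w : V}
    (hroot : G.RootedAt v) (hw : w ∈ G.verts) (h : G.Dominates v u w) (hne : u ≠ w) :
    ∃ z ∈ G.immSet v u, G.Dominates v z w := by
  classical
  obtain ⟨z, hz, hmax⟩ := Finset.exists_max_image
    (G.verts.filter fun z => u ≠ z ∧ G.Dominates v u z ∧ G.Dominates v z w)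
    (fun z => (G.domSet v z).card) ⟨w, by simp [hw, hne, h, Dominates.refl]⟩
  simp only [Finset.mem_filter] at hz hmax
  refine ⟨z, mem_immSet.2 ⟨hz.1, hz.2.1, hz.2.2.1, fun x hx hxu hxz hxd => ?_⟩, hz.2.2.2⟩
  rcases hxd.total hz.2.2.1 (hroot.2.2 z hz.1) with h' | h'
  · exact h'
  · have := dominates_of_card_le hxd hx (hmax x ⟨hx, Ne.symm hxu, h', hxd.trans hz.2.2.2⟩)
    exact absurd (hxd.antisymm this (hroot.2.2 z hz.1)) hxz

theorem not_dominates_of_mem_immSet {G : MultiDigraph V ε} {v u z : V} (hroot : G.RootedAt v)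
    (hz : z ∈ G.immSet v u) : ¬ G.Dominates v z u := fun h => by
  rw [mem_immSet] at hz
  exact hz.2.1 (hz.2.2.1.antisymm h (hroot.2.2 z hz.1))

theorem eq_of_mem_immSet_of_dominates {G : MultiDigraph V ε} {v u z z' w : V}
    (hroot : G.RootedAt v) (hz : z ∈ G.immSet v u) (hz' : z' ∈ G.immSet v u)
    (hw : w ∈ G.verts) (h : G.Dominates v z w) (h' : G.Dominates v z' w) : z = z' := by
  wlog hd : G.Dominates v z z' generalizing z z'
  · exact (this hz' hz h' h ((h.total h' (hroot.2.2 w hw)).resolve_left hd)).symm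
  by_contra hne
  have hzu : z ≠ u := Ne.symm (mem_immSet.1 hz).2.1
  exact not_dominates_of_mem_immSet hroot hz
    ((mem_immSet.1 hz').2.2.2 z (mem_immSet.1 hz).1 hzu hne hd)

/-! ### Arborescences and rank functions -/

theorem IsArb.isArbAt_root {G : MultiDigraph V ε} {A : Finset ε} {v : V} (h : G.IsArb A)
    (hroot : G.RootedAt v) : G.IsArbAt A v := by
  obtain ⟨r, h⟩ := h
  rcases Relation.ReflTransGen.cases_tail (h.2.2.2.2.2 v hroot.1) with rfl | ⟨_, _, e, he, _, ht⟩
  · exact h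
  · exact absurd ht (hroot.2.1 e (h.1 he))

theorem IsArbAt.not_transGen_self {G : MultiDigraph V ε} {A : Finset ε} {r w : V}
    (h : G.IsArbAt A r) (hw : G.Reaches A r w) : ¬ Relation.TransGen (G.Step A) w w := by
  obtain ⟨-, -, hv, hr, huniq, -⟩ := h
  induction hw with
  | refl =>
    intro h
    obtain ⟨c, _, e, he, _, hc⟩ := Relation.TransGen.tail'_iff.1 h
    exact hr e he hc
  | @tail a b _ hab ih =>
    intro h
    obtain ⟨c, hbc, e, he, rfl, heb⟩ := Relation.TransGen.tail'_iff.1 h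
    obtain ⟨e', he', rfl, rfl⟩ := hab
    have : e = e' := (huniq _ (hv e' he').2 (hr e' he')).unique ⟨he, heb⟩ ⟨he', rfl⟩
    subst this
    exact ih (Relation.TransGen.head' ⟨e, he, rfl, rfl⟩ hbc)

theorem IsArbAt.exists_rank {G : MultiDigraph V ε} {A : Finset ε} {r : V}
    (h : G.IsArbAt A r) : ∃ f : V → ℕ, ∀ e ∈ A, f (G.src e) < f (G.tgt e) := by
  classical
  refine ⟨fun w => (G.verts.filter fun a => G.Reaches A a w).card, fun e he => ?_⟩
  have hverts := h.2.2.1 e he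
  refine Finset.card_lt_card (Finset.ssubset_iff_of_subset ?_ |>.2 ⟨G.tgt e, ?_, ?_⟩)
  · intro a ha
    simp only [Finset.mem_filter] at *
    exact ⟨ha.1, ha.2.tail ⟨e, he, rfl, rfl⟩⟩
  · simpa using ⟨hverts.2, Relation.ReflTransGen.refl⟩
  · simp only [Finset.mem_filter, not_and]
    intro _ hr
    exact h.not_transGen_self (h.2.2.2.2.2 _ hverts.2)
      (Relation.TransGen.tail' hr ⟨e, he, rfl, rfl⟩)

theorem reaches_of_rank {G : MultiDigraph V ε} {A : Finset ε} {r : V} {f : V → ℕ}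
    (hf : ∀ e ∈ A, f (G.src e) < f (G.tgt e))
    (hin : ∀ w ∈ G.verts, w ≠ r → ∃ e ∈ A, G.src e ∈ G.verts ∧ G.tgt e = w) :
    ∀ w ∈ G.verts, G.Reaches A r w := by
  intro w
  induction hn : f w using Nat.strong_induction_on generalizing w with
  | _ n ih =>
    intro hw
    by_cases hwr : w = r
    · exact hwr ▸ .refl
    obtain ⟨e, he, hs, rfl⟩ := hin w hw hwr
    exact (ih _ (hn ▸ hf e he) _ rfl hs).tail ⟨e, he, rfl, rfl⟩

/-- A rank function increasing along walks of `A` from the root is monotone for domination. -/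
theorem Dominates.rank_le {G : MultiDigraph V ε} {A : Finset ε} {v z x : V} {f : V → ℕ}
    (h : G.Dominates v z x) (hA : A ⊆ G.edges) (hf : ∀ e ∈ A, f (G.src e) < f (G.tgt e))
    (hx : G.Reaches A v x) : f z ≤ f x := by
  by_contra! hlt
  refine dominates_iff.1 h ?_
  clear h
  induction hx with
  | refl => exact .refl fun h => by simp [h] at hlt
  | tail _ hab ih =>
    obtain ⟨e, he, rfl, rfl⟩ := hab
    exact (ih ((hf e he).trans hlt)).step (hA he) rfl fun h => by simp [h] at hlt

/-! ### The local digraphs of the dominator tree -/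

variable [DecidableEq V]

/-- The digraph on `u` and the vertices it immediately dominates, obtained by contracting the
sets dominated by the latter. -/
noncomputable def localDigraph (G : MultiDigraph V ε) (v u : V) : MultiDigraph V ε :=
  (G.domContract v (G.immSet v u)).induce (insert u (G.immSet v u))

theorem localDigraph_tgt_of_mem {G : MultiDigraph V ε} {v u : V} {e : ε}
    (he : e ∈ (G.localDigraph v u).edges) : (G.localDigraph v u).tgt e = G.tgt e := by
  classical
  replace he := (Finset.mem_filter.1 (Finset.mem_filter.1 he).1).2
  simp only [localDigraph, induce, domContract]
  split_ifs with h
  · obtain ⟨z, hz, hd, hne⟩ := h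
    by_cases hs : G.Dominates v z (G.src e)
    · exact absurd ⟨hs, hd⟩ (he.1 z hz)
    · exact absurd ⟨hs, hd, hne⟩ (he.2 z hz)
  · rfl

theorem mem_edges_of_mem_localDigraph {G : MultiDigraph V ε} {v u : V} {e : ε}
    (he : e ∈ (G.localDigraph v u).edges) : e ∈ G.edges := by
  classical
  exact (Finset.mem_filter.1 (Finset.mem_filter.1 he).1).1

theorem tgt_mem_immSet_of_mem_localDigraph {G : MultiDigraph V ε} {v u : V} {e : ε}
    (he : e ∈ (G.localDigraph v u).edges) (hne : (G.localDigraph v u).tgt e ≠ u) :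
    G.tgt e ∈ G.immSet v u := by
  have h : (G.localDigraph v u).tgt e ∈ insert u (G.immSet v u) := (Finset.mem_filter.1 he).2.2
  rw [localDigraph_tgt_of_mem he] at h hne
  exact (Finset.mem_insert.1 h).resolve_left hne

/-- The source of an edge of the local digraph is `u` itself, or the immediately dominated
vertex whose dominated set contains the original source. -/
theorem localDigraph_src {G : MultiDigraph V ε} {v u : V} {e : ε} (hwf : G.WellFormed)
    (hroot : G.RootedAt v) (he : e ∈ G.edges) (hy : G.tgt e ∈ G.immSet v u) :
    ((G.localDigraph v u).src e = u ∧ G.src e = u) ∨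
      ((G.localDigraph v u).src e ∈ G.immSet v u ∧
        G.Dominates v ((G.localDigraph v u).src e) (G.src e)) := by
  classical
  have hx := (hwf e he).1
  have hud : G.Dominates v u (G.src e) :=
    (mem_immSet.1 hy).2.2.1.src_of_tgt he (mem_immSet.1 hy).2.1
  simp only [localDigraph, induce, domContract]
  split_ifs with h
  · exact .inr ⟨h.choose_spec.1, h.choose_spec.2.1⟩
  · by_cases hu : G.src e = u
    · exact .inl ⟨hu, hu⟩
    · obtain ⟨z, hz, hzd⟩ := exists_immSet_dominates hroot hx hud (Ne.symm hu)
      push Not at h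
      exact .inr ⟨(h z hz hzd).symm ▸ hz, .refl G v _⟩

theorem mem_localDigraph_edges {G : MultiDigraph V ε} {v u : V} {e : ε} (hwf : G.WellFormed)
    (hroot : G.RootedAt v) (he : e ∈ G.edges) (hy : G.tgt e ∈ G.immSet v u)
    (hnd : ¬ G.Dominates v (G.tgt e) (G.src e)) : e ∈ (G.localDigraph v u).edges := by
  classical
  have hsib : ∀ z ∈ G.immSet v u, G.Dominates v z (G.tgt e) → z = G.tgt e := fun z hz hd =>
    eq_of_mem_immSet_of_dominates hroot hz hy (hwf e he).2 hd (.refl G v _)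
  refine Finset.mem_filter.2 ⟨Finset.mem_filter.2 ⟨he, ?_, ?_⟩, ?_, ?_⟩
  · rintro z hz ⟨hs, ht⟩
    exact hnd (hsib z hz ht ▸ hs)
  · rintro z hz ⟨-, ht, hne⟩
    exact hne (hsib z hz ht).symm
  · rcases localDigraph_src hwf hroot he hy with h | h
    · exact Finset.mem_insert.2 (.inl h.1)
    · exact Finset.mem_insert_of_mem h.1
  · have : ¬ ∃ z ∈ G.immSet v u, G.Dominates v z (G.tgt e) ∧ G.tgt e ≠ z := by
      rintro ⟨z, hz, hd, hne⟩
      exact hne (hsib z hz hd).symm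
    simpa [domContract, this] using Or.inr hy

/-! ### Arborescences and their local pieces -/

theorem IsArbAt.localDigraph {G : MultiDigraph V ε} {A : Finset ε} {v : V} (hwf : G.WellFormed)
    (hroot : G.RootedAt v) (h : G.IsArbAt A v) (u : V) :
    (G.localDigraph v u).IsArbAt (A.filter fun e => G.tgt e ∈ G.immSet v u) u := by
  obtain ⟨f, hf⟩ := h.exists_rank
  obtain ⟨hA, -, hverts, -, huniq, hreach⟩ := h
  have hmem : ∀ e ∈ A, G.tgt e ∈ G.immSet v u → e ∈ (G.localDigraph v u).edges := by
    intro e he hy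
    refine mem_localDigraph_edges hwf hroot (hA he) hy fun hd => ?_
    have := hd.rank_le hA hf (hreach _ (hverts e he).1)
    exact absurd (hf e he) (not_lt.2 this)
  have huu : u ∉ G.immSet v u := fun h => (mem_immSet.1 h).2.1 rfl
  have hinv : ∀ w ∈ (G.localDigraph v u).verts, w ≠ u → w ∈ G.immSet v u := fun w hw hne =>
    (Finset.mem_insert.1 hw).resolve_left hne
  have hin : ∀ w ∈ (G.localDigraph v u).verts, w ≠ u → ∃! e,
      e ∈ (A.filter fun e => G.tgt e ∈ G.immSet v u) ∧ (G.localDigraph v u).tgt e = w := by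
    intro w hw hwu
    have hwi := hinv w hw hwu
    have hwv : w ≠ v := by
      rintro rfl
      exact not_dominates_of_mem_immSet hroot hwi (.root G _ _)
    obtain ⟨e, ⟨he, rfl⟩, heu⟩ := huniq w (mem_immSet.1 hwi).1 hwv
    refine ⟨e, ⟨Finset.mem_filter.2 ⟨he, hwi⟩, localDigraph_tgt_of_mem (hmem e he hwi)⟩, ?_⟩
    rintro e' ⟨he', ht⟩
    rw [Finset.mem_filter] at he'
    rw [localDigraph_tgt_of_mem (hmem e' he'.1 he'.2)] at ht
    exact heu e' ⟨he'.1, ht⟩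
  have hends : ∀ e ∈ A.filter fun e => G.tgt e ∈ G.immSet v u,
      (G.localDigraph v u).src e ∈ (G.localDigraph v u).verts ∧
        (G.localDigraph v u).tgt e ∈ (G.localDigraph v u).verts := by
    intro e he
    rw [Finset.mem_filter] at he
    exact (Finset.mem_filter.1 (hmem e he.1 he.2)).2
  refine ⟨?_, Finset.mem_insert_self _ _, hends, ?_, hin, ?_⟩
  · intro e he
    rw [Finset.mem_filter] at he
    exact hmem e he.1 he.2
  · intro e he
    rw [Finset.mem_filter] at he
    rw [localDigraph_tgt_of_mem (hmem e he.1 he.2)]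
    exact fun h => huu (h ▸ he.2)
  · refine reaches_of_rank (f := f) ?_ fun w hw hne => ?_
    · intro e he
      rw [Finset.mem_filter] at he
      rw [localDigraph_tgt_of_mem (hmem e he.1 he.2)]
      refine lt_of_le_of_lt ?_ (hf e he.1)
      rcases localDigraph_src hwf hroot (hA he.1) he.2 with h | h
      · rw [h.1, h.2]
      · exact h.2.rank_le hA hf (hreach _ (hverts e he.1).1)
    · obtain ⟨e, he, -⟩ := hin w hw hne
      exact ⟨e, he.1, (hends e he.1).1, he.2⟩

theorem isArbAt_of_localDigraph {G : MultiDigraph V ε} {A : Finset ε} {v : V}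
    (hwf : G.WellFormed) (hroot : G.RootedAt v) (hA : A ⊆ G.edges)
    (h : ∀ u ∈ G.verts,
      (G.localDigraph v u).IsArbAt (A.filter fun e => G.tgt e ∈ G.immSet v u) u) :
    G.IsArbAt A v := by
  have hdom : ∀ n, ∀ u ∈ G.verts, (G.domSet v u).card = n →
      ∀ w ∈ G.verts, G.Dominates v u w → G.Reaches A u w := by
    intro n
    induction n using Nat.strong_induction_on with
    | _ n ih =>
      intro u hu hn
      have hsub : ∀ z ∈ G.immSet v u, ∀ w ∈ G.verts, G.Dominates v z w → G.Reaches A z w := by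
        intro z hz
        refine ih _ ?_ z (mem_immSet.1 hz).1 rfl
        by_contra! hle
        exact not_dominates_of_mem_immSet hroot hz
          (dominates_of_card_le (mem_immSet.1 hz).2.2.1 hu (hn ▸ hle))
      have hchild : ∀ z, (G.localDigraph v u).Reaches
          (A.filter fun e => G.tgt e ∈ G.immSet v u) u z → G.Reaches A u z := by
        intro z hz
        induction hz with
        | refl => exact .refl
        | tail _ hab ihz =>
          obtain ⟨e, he, rfl, rfl⟩ := hab
          rw [localDigraph_tgt_of_mem ((h u hu).1 he)]
          rw [Finset.mem_filter] at he
          refine Relation.ReflTransGen.tail ?_ ⟨e, he.1, rfl, rfl⟩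
          rcases localDigraph_src hwf hroot (hA he.1) he.2 with hs | hs
          · exact hs.2 ▸ .refl
          · exact ihz.trans (hsub _ hs.1 _ (hwf e (hA he.1)).1 hs.2)
      intro w hw hd
      by_cases huw : u = w
      · exact huw ▸ .refl
      obtain ⟨z, hz, hzd⟩ := exists_immSet_dominates hroot hw hd huw
      exact (hchild z ((h u hu).2.2.2.2.2 z (Finset.mem_insert_of_mem hz))).trans
        (hsub z hz w hw hzd)
  refine ⟨hA, hroot.1, fun e he => hwf e (hA he), fun e he => hroot.2.1 e (hA he), ?_,
    fun w hw => hdom _ v hroot.1 rfl w hw (.root G v w)⟩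
  intro w hw hwv
  obtain ⟨u, hu, hwu⟩ := exists_immSet hroot hw hwv
  obtain ⟨e, ⟨he, ht⟩, heu⟩ := (h u hu).2.2.2.2.1 w (Finset.mem_insert_of_mem hwu)
    (Ne.symm (mem_immSet.1 hwu).2.1)
  rw [localDigraph_tgt_of_mem ((h u hu).1 he)] at ht
  refine ⟨e, ⟨(Finset.mem_filter.1 he).1, ht⟩, ?_⟩
  rintro e' ⟨he', rfl⟩
  have hf' : e' ∈ A.filter fun e => G.tgt e ∈ G.immSet v u := Finset.mem_filter.2 ⟨he', hwu⟩
  exact heu e' ⟨hf', localDigraph_tgt_of_mem ((h u hu).1 hf')⟩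

theorem IsArbAt.tgt_mem_immSet {G : MultiDigraph V ε} {B : Finset ε} {v u : V}
    (h : (G.localDigraph v u).IsArbAt B u) {e : ε} (he : e ∈ B) : G.tgt e ∈ G.immSet v u :=
  tgt_mem_immSet_of_mem_localDigraph (h.1 he) (h.2.2.2.1 e he)

end MultiDigraph

open MvPolynomial

variable {V : Type*} {ε : Type*} [DecidableEq V] [DecidableEq ε]

/-- For `G` rooted at `v`,
`κ(G) = ∏_{u ∈ V} κ_u(H_u[{u} ∪ imm_G(u)])`, where
`H_u = G(dom_G(u₁) → u₁; …; dom_G(u_i) → u_i)` with `{u₁, …, u_i} = imm_G(u)`. -/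
theorem statement_9 (G : MultiDigraph V ε) (hwf : G.WellFormed) (hsimple : G.Simple)
    (v : V) (hroot : G.RootedAt v) :
    G.kirchhoff =
      ∏ u ∈ G.verts,
        ((G.domContract v (G.immSet v u)).induce (insert u (G.immSet v u))).kirchhoffAt u := by
  classical
  change G.kirchhoff = ∏ u ∈ G.verts, (G.localDigraph v u).kirchhoffAt u
  simp only [MultiDigraph.kirchhoff, MultiDigraph.kirchhoffAt]
  rw [Finset.prod_sum]
  have hpiece : ∀ p ∈ G.verts.pi (fun u => (G.localDigraph v u).edges.powerset.filter
      fun B => (G.localDigraph v u).IsArbAt B u), ∀ u (hu : u ∈ G.verts),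
      (G.localDigraph v u).IsArbAt (p u hu) u := fun p hp u hu =>
    (Finset.mem_filter.1 (Finset.mem_pi.1 hp u hu)).2
  have hfilter : ∀ p ∈ G.verts.pi (fun u => (G.localDigraph v u).edges.powerset.filter
      fun B => (G.localDigraph v u).IsArbAt B u), ∀ u (hu : u ∈ G.verts),
      (G.verts.attach.biUnion fun x => p x.1 x.2).filter (fun e => G.tgt e ∈ G.immSet v u) =
        p u hu := by
    intro p hp u hu
    ext e
    simp only [Finset.mem_filter, Finset.mem_biUnion, Finset.mem_attach, true_and,
      Subtype.exists]
    constructor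
    · rintro ⟨⟨u', hu', he⟩, ht⟩
      obtain rfl := MultiDigraph.immSet_unique hroot hu' hu
        ((hpiece p hp u' hu').tgt_mem_immSet he) ht
      exact he
    · exact fun he => ⟨⟨u, hu, he⟩, (hpiece p hp u hu).tgt_mem_immSet he⟩
  have hunion : ∀ A, G.IsArbAt A v →
      (G.verts.attach.biUnion fun x => A.filter fun e => G.tgt e ∈ G.immSet v x.1) = A := by
    intro A hA
    ext e
    simp only [Finset.mem_filter, Finset.mem_biUnion, Finset.mem_attach, true_and,
      Subtype.exists]
    constructor
    · rintro ⟨_, _, he, _⟩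
      exact he
    · intro he
      obtain ⟨u, hu, ht⟩ := MultiDigraph.exists_immSet hroot (hwf e (hA.1 he)).2
        (hroot.2.1 e (hA.1 he))
      exact ⟨u, hu, he, ht⟩
  refine Finset.sum_bij' (fun A _ u _ => A.filter fun e => G.tgt e ∈ G.immSet v u)
    (fun p _ => G.verts.attach.biUnion fun x => p x.1 x.2) ?_ ?_ ?_ ?_ ?_
  · intro A hA
    have hA := (Finset.mem_filter.1 hA).2.isArbAt_root hroot
    refine Finset.mem_pi.2 fun u _ => Finset.mem_filter.2 ⟨?_, hA.localDigraph hwf hroot u⟩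
    exact Finset.mem_powerset.2 (hA.localDigraph hwf hroot u).1
  · intro p hp
    have hsub : (G.verts.attach.biUnion fun x => p x.1 x.2) ⊆ G.edges :=
      Finset.biUnion_subset.2 fun x _ e he =>
        MultiDigraph.mem_edges_of_mem_localDigraph ((hpiece p hp x.1 x.2).1 he)
    refine Finset.mem_filter.2 ⟨Finset.mem_powerset.2 hsub, v, ?_⟩
    refine MultiDigraph.isArbAt_of_localDigraph hwf hroot hsub fun u hu => ?_
    rw [hfilter p hp u hu]
    exact hpiece p hp u hu
  · intro A hA
    exact hunion A ((Finset.mem_filter.1 hA).2.isArbAt_root hroot)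
  · intro p hp
    funext u hu
    exact hfilter p hp u hu
  · intro A hA
    have hA := (Finset.mem_filter.1 hA).2.isArbAt_root hroot
    conv_lhs => rw [← hunion A hA]
    refine Finset.prod_biUnion fun x _ y _ hxy => ?_
    refine Finset.disjoint_left.2 fun e hx hy => hxy (Subtype.ext ?_)
    exact MultiDigraph.immSet_unique hroot x.2 y.2 (Finset.mem_filter.1 hx).2
      (Finset.mem_filter.1 hy).2
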